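/- For every signed graph (G,σ) and every positive integer k, the chromatic number of the exact-distance -k graph of (G,σ) is at most ((wcol_k(G)+1)·(⌊k/2⌋+2)·3)^q, where q = wcol_{⌊k/2⌋}(G). -/

import Mathlib

open SimpleGraph

/-- The number of negative edges of a walk, where `σ e = true` means edge `e` is negative. -/
def negCount {V : Type} {G : SimpleGraph V} (σ : Sym2 V → Bool) {x y : V}
    (p : G.Walk x y) : ℕ :=
  (p.edges.filter (fun e => σ e)).length

/-- A walk is negative if it contains an odd number of negative edges. -/
def IsNegWalk {V : Type} {G : SimpleGraph V} (σ : Sym2 V → Bool) {x y : V}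
    (p : G.Walk x y) : Prop :=
  Odd (negCount σ p)

/-- The exact-distance `-k` graph of the signed graph `(G, σ)`:
`xy` is an edge iff `d_G(x,y) = k` and every `xy`-path of length `k` is negative. -/
def exactDistNeg {V : Type} (G : SimpleGraph V) (σ : Sym2 V → Bool) (k : ℕ) :
    SimpleGraph V :=
  SimpleGraph.fromRel (fun x y =>
    G.dist x y = k ∧ ∀ p : G.Walk x y, p.IsPath → p.length = k → IsNegWalk σ p)

/-- The strong exact-distance `-k` graph of the signed graph `(G, σ)`:
`xy` is an edge iff `d_G(x,y) = k` and some `xy`-path of length `k` is negative. -/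
def strongExactDistNeg {V : Type} (G : SimpleGraph V) (σ : Sym2 V → Bool) (k : ℕ) :
    SimpleGraph V :=
  SimpleGraph.fromRel (fun x y =>
    G.dist x y = k ∧ ∃ p : G.Walk x y, p.IsPath ∧ p.length = k ∧ IsNegWalk σ p)

/-- `WReach G L k y` : the set of vertices weakly `k`-reachable from `y` w.r.t. ordering `L`. -/
def WReach {V : Type} (G : SimpleGraph V) (L : LinearOrder V) (k : ℕ) (y : V) : Set V :=
  {x | ∃ p : G.Walk x y, p.IsPath ∧ p.length ≤ k ∧ ∀ z ∈ p.support, L.le x z}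

/-- The weak `k`-colouring number of `G`. -/
noncomputable def wcol {V : Type} (G : SimpleGraph V) (k : ℕ) : ℕ :=
  ⨅ L : LinearOrder V, ⨆ y : V, (WReach G L k y).ncard

/-- `DReach G L k y` : the set of vertices `x` such that there is an `xy`-path
`z_0, …, z_s` (`x = z_0`, `y = z_s`) of length `s ≤ k` on which `x` is the `L`-minimum
and `y ≤_L z_i` for all `⌊k/2⌋ + 1 ≤ i ≤ s`. -/
def DReach {V : Type} (G : SimpleGraph V) (L : LinearOrder V) (k : ℕ) (y : V) : Set V :=
  {x | ∃ p : G.Walk x y, p.IsPath ∧ p.length ≤ k ∧ (∀ z ∈ p.support, L.le x z) ∧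
        ∀ i, k / 2 + 1 ≤ i → i ≤ p.length → L.le y (p.support.getD i y)}

/-- The distance-`k`-colouring number of `G`. -/
noncomputable def dcol {V : Type} (G : SimpleGraph V) (k : ℕ) : ℕ :=
  ⨅ L : LinearOrder V, ⨆ y : V, (DReach G L k y).ncard

/-- `SReach G L k y` : the set of vertices strongly `k`-reachable from `y` w.r.t. `L`. -/
def SReach {V : Type} (G : SimpleGraph V) (L : LinearOrder V) (k : ℕ) (y : V) : Set V :=
  {x | ∃ p : G.Walk x y, p.IsPath ∧ p.length ≤ k ∧ (∀ z ∈ p.support, L.le x z) ∧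
        ∀ z ∈ p.support, z ≠ x → L.le y z}

/-- The strong `k`-colouring number of `G`. -/
noncomputable def scol {V : Type} (G : SimpleGraph V) (k : ℕ) : ℕ :=
  ⨅ L : LinearOrder V, ⨆ y : V, (SReach G L k y).ncard

/-- `H` is a minor of `G` (branch-set definition). -/
def IsMinor {W V : Type} (H : SimpleGraph W) (G : SimpleGraph V) : Prop :=
  ∃ B : W → Set V,
    (∀ w, (B w).Nonempty) ∧
    (∀ w, (G.induce (B w)).Connected) ∧
    (Pairwise (Function.onFun Disjoint B)) ∧
    ∀ w w', H.Adj w w' → ∃ u ∈ B w, ∃ v ∈ B w', G.Adj u v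

/-- `G` is planar iff it has no `K₅` and no `K₃,₃` minor (Wagner's theorem). -/
def IsPlanar {V : Type} (G : SimpleGraph V) : Prop :=
  ¬ IsMinor (completeGraph (Fin 5)) G ∧
  ¬ IsMinor (completeBipartiteGraph (Fin 3) (Fin 3)) G

/-- `G` is outerplanar iff it has no `K₄` and no `K₂,₃` minor. -/
def IsOuterplanar {V : Type} (G : SimpleGraph V) : Prop :=
  ¬ IsMinor (completeGraph (Fin 4)) G ∧
  ¬ IsMinor (completeBipartiteGraph (Fin 2) (Fin 3)) G

/-- `G` has treewidth at most `t` (tree-decomposition definition). -/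
def HasTreewidthLE {V : Type} (G : SimpleGraph V) (t : ℕ) : Prop :=
  ∃ (ι : Type) (T : SimpleGraph ι) (B : ι → Finset V),
    T.Connected ∧ T.IsAcyclic ∧
    (∀ v, ∃ i, v ∈ B i) ∧
    (∀ u v, G.Adj u v → ∃ i, u ∈ B i ∧ v ∈ B i) ∧
    (∀ v, (T.induce {i | v ∈ B i}).Connected) ∧
    (∀ i, (B i).card ≤ t + 1)

/-- Every walk splits at a vertex which is minimal on it. -/
lemma SimpleGraph.Walk.exists_append_minimal {V : Type} {G : SimpleGraph V} (L : LinearOrder V)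
    {u v : V} (p : G.Walk u v) :
    ∃ (x : V) (r : G.Walk u x) (t : G.Walk x v), p = r.append t ∧
      ∀ z ∈ p.support, L.le x z := by
  classical
  obtain ⟨x, hx, hmin⟩ := Finset.exists_min_image p.support.toFinset (fun z => z)
    ⟨u, by simp⟩
  obtain ⟨r, t, h⟩ := Walk.mem_support_iff_exists_append.1 (List.mem_toFinset.1 hx)
  exact ⟨x, r, t, h, fun z hz => hmin z (List.mem_toFinset.2 hz)⟩

/-- Walks, and not only paths, witness weak reachability. -/
lemma mem_WReach_of_walk {V : Type} {G : SimpleGraph V} {L : LinearOrder V} {k : ℕ} {x y : V}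
    (p : G.Walk x y) (hk : p.length ≤ k) (h : ∀ z ∈ p.support, L.le x z) :
    x ∈ WReach G L k y := by
  classical
  exact ⟨p.bypass, p.bypass_isPath, p.length_bypass_le_length.trans hk,
    fun z hz => h z (p.support_bypass_subset_support hz)⟩

/-- Some linear order attains the weak colouring number. -/
lemma exists_order_wcol {V : Type} [Fintype V] (G : SimpleGraph V) (k : ℕ) :
    ∃ L : LinearOrder V, ∀ y, (WReach G L k y).ncard ≤ wcol G k := by
  have : Nonempty (LinearOrder V) :=
    ⟨LinearOrder.lift' (Fintype.equivFin V) (Fintype.equivFin V).injective⟩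
  obtain ⟨L, hL⟩ := Nat.sInf_mem
    (Set.range_nonempty fun L : LinearOrder V => ⨆ y : V, (WReach G L k y).ncard)
  refine ⟨L, fun y => ?_⟩
  refine le_trans ?_ (le_of_eq hL)
  exact le_ciSup (f := fun y => (WReach G L k y).ncard) (Set.finite_range _).bddAbove y

/-- A digraph of out-degree at most `D` has a vertex of total degree at most `2 * D` in every
nonempty vertex set. -/
lemma exists_card_filter_add_le {V : Type} [DecidableEq V] (A : V → Finset V) (D : ℕ)
    (hA : ∀ v, (A v).card ≤ D) (Z : Finset V) (hZ : Z.Nonempty) :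
    ∃ z ∈ Z, (A z ∩ Z).card + (Z.filter fun w => z ∈ A w).card ≤ 2 * D := by
  have hdc : ∑ z ∈ Z, (Z.filter fun w => z ∈ A w).card = ∑ w ∈ Z, (A w ∩ Z).card := by
    have := Finset.sum_card_bipartiteAbove_eq_sum_card_bipartiteBelow (s := Z) (t := Z)
      (fun z w => z ∈ A w)
    simp only [Finset.bipartiteAbove, Finset.bipartiteBelow] at this
    rw [this]
    refine Finset.sum_congr rfl fun w _ => ?_
    congr 1
    ext a
    simp [and_comm]
  refine Finset.exists_le_of_sum_le (g := fun _ => 2 * D) hZ ?_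
  rw [Finset.sum_add_distrib, hdc, ← two_mul, ← Finset.mul_sum]
  gcongr with w
  exact (Finset.card_le_card Finset.inter_subset_left).trans (hA w)

/-- Greedy list colouring of a digraph of out-degree at most `D` from lists of size `2 * D + 1`. -/
lemma exists_list_colouring {V τ : Type} [Fintype V] (A : V → Finset V) (D : ℕ)
    (hA : ∀ v, (A v).card ≤ D) (good : V → Finset τ) (hg : ∀ v, 2 * D + 1 ≤ (good v).card) :
    ∃ F : V → τ, (∀ v, F v ∈ good v) ∧ ∀ u v, u ≠ v → u ∈ A v → F u ≠ F v := by
  classical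
  have hne : ∀ v, ∃ t, t ∈ good v := fun v =>
    Finset.card_pos.1 (lt_of_lt_of_le (Nat.succ_pos _) (hg v))
  choose F₀ hF₀ using hne
  suffices H : ∀ (n : ℕ) (Z : Finset V), Z.card = n → ∃ F : V → τ, (∀ v, F v ∈ good v) ∧
      ∀ u ∈ Z, ∀ v ∈ Z, u ≠ v → u ∈ A v → F u ≠ F v by
    obtain ⟨F, h1, h2⟩ := H _ Finset.univ rfl
    exact ⟨F, h1, fun u v => h2 u (Finset.mem_univ _) v (Finset.mem_univ _)⟩
  intro n
  induction n with
  | zero =>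
    intro Z hZ
    rw [Finset.card_eq_zero] at hZ
    exact ⟨F₀, hF₀, by simp [hZ]⟩
  | succ n ih =>
    intro Z hZ
    obtain ⟨z, hz, hdeg⟩ := exists_card_filter_add_le A D hA Z
      (Finset.card_pos.1 (by omega))
    obtain ⟨F, hF1, hF2⟩ := ih (Z.erase z) (by rw [Finset.card_erase_of_mem hz]; omega)
    have hcard : ((A z ∩ Z ∪ Z.filter fun w => z ∈ A w).image F).card < (good z).card :=
      calc _ ≤ _ := Finset.card_image_le
        _ ≤ _ := Finset.card_union_le _ _
        _ < _ := lt_of_le_of_lt hdeg (hg z)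
    obtain ⟨t, ht, htn⟩ := Finset.exists_mem_notMem_of_card_lt_card hcard
    refine ⟨Function.update F z t, fun v => ?_, fun u hu v hv huv huA => ?_⟩
    · by_cases h : v = z
      · subst h; simpa using ht
      · simpa [h] using hF1 v
    · by_cases h1 : u = z
      · subst h1
        rw [Function.update_self, Function.update_of_ne huv.symm]
        rintro rfl
        exact htn (Finset.mem_image_of_mem _ (by simp [hv, huA]))
      · by_cases h2 : v = z
        · subst h2
          rw [Function.update_self, Function.update_of_ne huv]
          rintro rfl
          exact htn (Finset.mem_image_of_mem _ (by simp [hu, huA]))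
        · rw [Function.update_of_ne h1, Function.update_of_ne h2]
          exact hF2 u (by simp [h1, hu]) v (by simp [h2, hv]) huv huA

lemma negCount_append {V : Type} {G : SimpleGraph V} (σ : Sym2 V → Bool) {x y z : V}
    (p : G.Walk x y) (q : G.Walk y z) :
    negCount σ (p.append q) = negCount σ p + negCount σ q := by
  simp [negCount, Walk.edges_append]

lemma negCount_reverse {V : Type} {G : SimpleGraph V} (σ : Sym2 V → Bool) {x y : V}
    (p : G.Walk x y) : negCount σ p.reverse = negCount σ p := by
  simp [negCount, Walk.edges_reverse]

/-- A walk of minimal length which splits at `x` consists of two walks of minimal length. -/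
lemma dist_eq_length_of_append {V : Type} {G : SimpleGraph V} {u x v : V} (p : G.Walk u x)
    (q : G.Walk x v) (h : (p.append q).length = G.dist u v) :
    G.dist u x = p.length ∧ G.dist x v = q.length := by
  obtain ⟨a, ha⟩ := (p.reachable).exists_walk_length_eq_dist
  obtain ⟨b, hb⟩ := (q.reachable).exists_walk_length_eq_dist
  have h1 := G.dist_le p
  have h2 := G.dist_le q
  have h3 := G.dist_le (a.append b)
  rw [Walk.length_append] at h h3
  omega

open Classical in
/-- Whether some shortest walk from `u` to `y` is negative. -/
noncomputable def geodesicSign {V : Type} (G : SimpleGraph V) (σ : Sym2 V → Bool) (u y : V) :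
    Bool :=
  decide (∃ p : G.Walk u y, p.length = G.dist u y ∧ IsNegWalk σ p)

open Classical in
/-- The vertices that can be reached from `v` by weak reachability for `L₁` within distance `k`
followed by weak reachability for `L₂` within distance `h`. -/
noncomputable def twoStepReach {V : Type} [Fintype V] (G : SimpleGraph V) (L₁ L₂ : LinearOrder V)
    (k h : ℕ) (v : V) : Finset V :=
  (WReach G L₁ k v).toFinset.biUnion fun x => (WReach G L₂ h x).toFinset

lemma mem_twoStepReach {V : Type} [Fintype V] {G : SimpleGraph V} {L₁ L₂ : LinearOrder V}
    {k h : ℕ} {v y : V} :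
    y ∈ twoStepReach G L₁ L₂ k h v ↔ ∃ x ∈ WReach G L₁ k v, y ∈ WReach G L₂ h x := by
  simp [twoStepReach]

lemma card_twoStepReach_le {V : Type} [Fintype V] {G : SimpleGraph V} {L₁ L₂ : LinearOrder V}
    {k h d q : ℕ} (hd : ∀ y, (WReach G L₁ k y).ncard ≤ d) (hq : ∀ y, (WReach G L₂ h y).ncard ≤ q)
    (v : V) : (twoStepReach G L₁ L₂ k h v).card ≤ d * q := by
  classical
  refine (Finset.card_biUnion_le_card_mul _ _ q fun x _ => ?_).trans ?_
  · rw [← Set.ncard_eq_toFinset_card']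
    exact hq x
  · gcongr
    rw [← Set.ncard_eq_toFinset_card']
    exact hd v

/-- `y` is the `L`-minimum of a shortest walk of length at most `h` to the different vertex `u`. -/
def GeodesicReach {V : Type} (G : SimpleGraph V) (L : LinearOrder V) (h : ℕ) (u y : V) : Prop :=
  y ≠ u ∧ ∃ p : G.Walk y u, p.length = G.dist u y ∧ p.length ≤ h ∧ ∀ z ∈ p.support, L.le y z

/-- There is a shortest walk of length at most `k` from `v` to `y` with `L₁`-minimum `x`, whose
part from `x` to `y` has length at most `h` and `L₂`-minimum `y`. -/
def TwoStepGeodesicReach {V : Type} (G : SimpleGraph V) (L₁ L₂ : LinearOrder V) (k h : ℕ)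
    (v y : V) : Prop :=
  ∃ (x : V) (r : G.Walk v x) (t : G.Walk x y), r.length + t.length = G.dist v y ∧
    G.dist v y ≤ k ∧ t.length ≤ h ∧ (∀ z ∈ r.support, L₁.le x z) ∧
    ∀ z ∈ t.support, L₁.le x z ∧ L₂.le y z

lemma TwoStepGeodesicReach.mem_twoStepReach {V : Type} [Fintype V] {G : SimpleGraph V}
    {L₁ L₂ : LinearOrder V} {k h : ℕ} {v y : V} (H : TwoStepGeodesicReach G L₁ L₂ k h v y) :
    y ∈ twoStepReach G L₁ L₂ k h v := by
  obtain ⟨x, r, t, hlen, hk, hh, h1, h2⟩ := H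
  refine _root_.mem_twoStepReach.2 ⟨x, mem_WReach_of_walk r.reverse ?_ ?_,
    mem_WReach_of_walk t.reverse ?_ ?_⟩
  · rw [Walk.length_reverse]; omega
  · intro z hz
    exact h1 z (by simpa using hz)
  · rw [Walk.length_reverse]; omega
  · intro z hz
    exact (h2 z (by simpa using hz)).2

/-- Two vertices reached from `v` in the two possible ways are related by `twoStepReach`, if their
distances to `v` add up to at most `k`. -/
lemma GeodesicReach.mem_twoStepReach_or {V : Type} [Fintype V] {G : SimpleGraph V}
    {L₁ L₂ : LinearOrder V} {k h : ℕ} {v y y' : V} (H' : GeodesicReach G L₂ h v y')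
    (H : TwoStepGeodesicReach G L₁ L₂ k h v y) (hk : G.dist v y + G.dist v y' ≤ k) :
    y' ∈ twoStepReach G L₁ L₂ k h y ∨ y ∈ twoStepReach G L₁ L₂ k h y' := by
  obtain ⟨x, r, t, hlen, -, hh, h1, h2⟩ := H
  obtain ⟨-, p, hp, hph, hpm⟩ := H'
  obtain ⟨w, p₁, p₂, hpe, hw⟩ := p.exists_append_minimal L₁
  have hpl : p.length = p₁.length + p₂.length := by rw [hpe, Walk.length_append]
  rcases L₁.le_total w x with hwx | hxw
  · left
    refine mem_twoStepReach.2 ⟨w, mem_WReach_of_walk ((p₂.append r).append t) ?_ ?_,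
      mem_WReach_of_walk p₁ ?_ ?_⟩
    · simp only [Walk.length_append]; omega
    · intro z hz
      rw [Walk.mem_support_append_iff, Walk.mem_support_append_iff] at hz
      rcases hz with (hz | hz) | hz
      · exact hw z (by rw [hpe, Walk.mem_support_append_iff]; exact Or.inr hz)
      · exact L₁.le_trans _ _ _ hwx (h1 z hz)
      · exact L₁.le_trans _ _ _ hwx (h2 z hz).1
    · omega
    · intro z hz
      exact hpm z (by rw [hpe, Walk.mem_support_append_iff]; exact Or.inl hz)
  · right
    refine mem_twoStepReach.2 ⟨x, mem_WReach_of_walk (r.reverse.append p.reverse) ?_ ?_,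
      mem_WReach_of_walk t.reverse ?_ ?_⟩
    · simp only [Walk.length_append, Walk.length_reverse]; omega
    · intro z hz
      rw [Walk.mem_support_append_iff] at hz
      rcases hz with hz | hz
      · exact h1 z (by simpa using hz)
      · exact L₁.le_trans _ _ _ hxw (hw z (by simpa using hz))
    · rw [Walk.length_reverse]; omega
    · intro z hz
      exact (h2 z (by simpa using hz)).2

open Classical in
/-- The labels (colour, distance, sign) of the vertices `y` with `GeodesicReach G L h u y`. -/
noncomputable def reachLabels {V : Type} (G : SimpleGraph V) (σ : Sym2 V → Bool)
    (L : LinearOrder V) (h : ℕ) {C : ℕ} (c : V → Fin C) (u : V) :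
    Finset (Fin C × Fin h × Bool) :=
  Finset.univ.filter fun ω => ∃ y, GeodesicReach G L h u y ∧ c y = ω.1 ∧
    G.dist u y = ω.2.1 + 1 ∧ geodesicSign G σ u y = ω.2.2

open Classical in
/-- The labels which a vertex `u` with an edge to `v` of the exact-distance graph may have on a
shortest walk from `u` to `v`. -/
noncomputable def conflictLabels {V : Type} (G : SimpleGraph V) (σ : Sym2 V → Bool)
    (L₁ L₂ : LinearOrder V) (k h : ℕ) {C : ℕ} (c : V → Fin C) (v : V) :
    Finset (Fin C × Fin h × Bool) :=
  Finset.univ.filter fun ω => ∃ y, TwoStepGeodesicReach G L₁ L₂ k h v y ∧ c y = ω.1 ∧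
    G.dist v y + (ω.2.1 + 1) = k ∧ geodesicSign G σ v y ≠ ω.2.2

lemma card_reachLabels_lt {V : Type} [Fintype V] {G : SimpleGraph V} (σ : Sym2 V → Bool)
    {L : LinearOrder V} {h q : ℕ} (hq : ∀ y, (WReach G L h y).ncard ≤ q) {C : ℕ} (c : V → Fin C)
    (u : V) : (reachLabels G σ L h c u).card < q := by
  classical
  refine lt_of_lt_of_le ?_ (hq u)
  rw [Set.ncard_eq_toFinset_card']
  have hu : u ∈ (WReach G L h u).toFinset := by
    rw [Set.mem_toFinset]
    exact mem_WReach_of_walk (Walk.nil : G.Walk u u) (by simp) (by simp)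
  refine lt_of_le_of_lt ?_ (Finset.card_erase_lt_of_mem hu)
  have hsurj : ∀ ω ∈ reachLabels G σ L h c u, ∃ y, GeodesicReach G L h u y ∧ c y = ω.1 ∧
    G.dist u y = ω.2.1 + 1 ∧ geodesicSign G σ u y = ω.2.2 := fun ω hω => by
      simpa [reachLabels] using hω
  have : Nonempty V := ⟨u⟩
  choose! f hf using hsurj
  refine Finset.card_le_card_of_injOn f ?_ ?_
  · intro ω hω
    obtain ⟨⟨hne, p, -, hp1, hp2⟩, -⟩ := hf ω hω
    simpa [hne] using mem_WReach_of_walk p hp1 hp2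
  · rintro ⟨i, l, b⟩ hω ⟨i', l', b'⟩ hω' he
    obtain ⟨-, h1, h2, h3⟩ := hf _ hω
    obtain ⟨-, h1', h2', h3'⟩ := hf _ hω'
    rw [he] at h1 h2 h3
    simp only [Prod.mk.injEq, Fin.ext_iff] at *
    refine ⟨?_, by omega, h3.symm.trans h3'⟩
    rw [← h1, ← h1']

lemma card_conflictLabels_le {V : Type} [Fintype V] {G : SimpleGraph V} (σ : Sym2 V → Bool)
    {L₁ L₂ : LinearOrder V} {k h d q : ℕ} (hd : ∀ y, (WReach G L₁ k y).ncard ≤ d)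
    (hq : ∀ y, (WReach G L₂ h y).ncard ≤ q) {C : ℕ} (c : V → Fin C) (v : V) :
    (conflictLabels G σ L₁ L₂ k h c v).card ≤ d * q := by
  classical
  refine le_trans ?_ (card_twoStepReach_le hd hq v)
  have hsurj : ∀ ω ∈ conflictLabels G σ L₁ L₂ k h c v, ∃ y, TwoStepGeodesicReach G L₁ L₂ k h v y ∧
    c y = ω.1 ∧ G.dist v y + (ω.2.1 + 1) = k ∧ geodesicSign G σ v y ≠ ω.2.2 := fun ω hω => by
      simpa [conflictLabels] using hω
  have : Nonempty V := ⟨v⟩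
  choose! f hf using hsurj
  refine Finset.card_le_card_of_injOn f ?_ ?_
  · intro ω hω
    exact (hf ω hω).1.mem_twoStepReach
  · rintro ⟨i, l, b⟩ hω ⟨i', l', b'⟩ hω' he
    obtain ⟨-, h1, h2, h3⟩ := hf _ hω
    obtain ⟨-, h1', h2', h3'⟩ := hf _ hω'
    rw [he] at h1 h2 h3
    simp only [Prod.mk.injEq, Fin.ext_iff] at *
    refine ⟨?_, by omega, ?_⟩
    · rw [← h1, ← h1']
    · revert h3 h3'
      cases b <;> cases b' <;> simp

lemma disjoint_reachLabels_conflictLabels {V : Type} [Fintype V] {G : SimpleGraph V}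
    (σ : Sym2 V → Bool) {L₁ L₂ : LinearOrder V} {k h C : ℕ} {c : V → Fin C}
    (hc : ∀ u v, u ≠ v → u ∈ twoStepReach G L₁ L₂ k h v → c u ≠ c v) (v : V) :
    Disjoint (reachLabels G σ L₂ h c v) (conflictLabels G σ L₁ L₂ k h c v) := by
  rw [Finset.disjoint_left]
  intro ω h1 h2
  simp only [reachLabels, conflictLabels, Finset.mem_filter, Finset.mem_univ, true_and] at h1 h2
  obtain ⟨y', hy', hc', hd', hs'⟩ := h1
  obtain ⟨y, hy, hcy, hd, hs⟩ := h2
  have hne : y ≠ y' := by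
    rintro rfl
    exact hs hs'
  rcases hy'.mem_twoStepReach_or hy (by omega) with h | h
  · exact hc _ _ hne.symm h (hc'.trans hcy.symm)
  · exact hc _ _ hne h (hcy.trans hc'.symm)

/-- Along a shortest walk all of whose replacements are negative, the signs seen from the two
ends differ. -/
lemma geodesicSign_ne {V : Type} {G : SimpleGraph V} {σ : Sym2 V → Bool} {u y v : V}
    (hneg : ∀ p : G.Walk u v, p.length = G.dist u v → IsNegWalk σ p)
    (s : G.Walk u y) (t : G.Walk y v) (hlen : (s.append t).length = G.dist u v) :
    geodesicSign G σ v y ≠ geodesicSign G σ u y := by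
  obtain ⟨h1, h2⟩ := dist_eq_length_of_append s t hlen
  rw [Walk.length_append] at hlen
  unfold geodesicSign
  intro h
  rw [decide_eq_decide] at h
  by_cases hu : ∃ p : G.Walk u y, p.length = G.dist u y ∧ IsNegWalk σ p
  · obtain ⟨b, hb, hbn⟩ := h.2 hu
    obtain ⟨a, ha, han⟩ := hu
    rw [dist_comm] at hb
    have := hneg (a.append b.reverse) (by simp only [Walk.length_append, Walk.length_reverse]; omega)
    unfold IsNegWalk at *
    rw [negCount_append, negCount_reverse] at this
    exact (Nat.not_odd_iff_even.2 (han.add_odd hbn)) this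
  · have hv := fun h' => hu (h.1 h')
    have hs : ¬ IsNegWalk σ s := fun hs => hu ⟨s, h1.symm, hs⟩
    have ht : ¬ IsNegWalk σ t := fun ht => hv ⟨t.reverse, by rw [Walk.length_reverse, dist_comm, h2],
      by unfold IsNegWalk at *; rwa [negCount_reverse]⟩
    have := hneg (s.append t) (by rw [Walk.length_append]; omega)
    unfold IsNegWalk at *
    rw [negCount_append] at this
    rw [Nat.not_odd_iff_even] at hs ht
    exact (Nat.not_odd_iff_even.2 (hs.add ht)) this

/-- The main structural fact about edges of the exact-distance graph. -/
lemma mem_twoStepReach_or_exists_label {V : Type} [Fintype V] {G : SimpleGraph V}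
    {σ : Sym2 V → Bool} {L₁ L₂ : LinearOrder V} {k h C : ℕ} (c : V → Fin C) {u x v : V}
    (hdist : G.dist u v = k)
    (hneg : ∀ p : G.Walk u v, p.length = G.dist u v → IsNegWalk σ p)
    (p₁ : G.Walk u x) (p₂ : G.Walk x v) (hlen : (p₁.append p₂).length = G.dist u v)
    (hx : ∀ z ∈ (p₁.append p₂).support, L₁.le x z) (hh : p₁.length ≤ h) :
    u ∈ twoStepReach G L₁ L₂ k h v ∨
      ∃ ω, ω ∈ reachLabels G σ L₂ h c u ∧ ω ∈ conflictLabels G σ L₁ L₂ k h c v := by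
  obtain ⟨y, s₁, s₂, hs, hy⟩ := p₁.exists_append_minimal L₂
  have hlen' := hlen
  rw [hs, ← Walk.append_assoc] at hlen'
  obtain ⟨h1, h2⟩ := dist_eq_length_of_append _ _ hlen'
  have hsl : p₁.length = s₁.length + s₂.length := by rw [hs, Walk.length_append]
  rw [Walk.length_append] at hlen h2
  have hact : TwoStepGeodesicReach G L₁ L₂ k h v y := by
    refine ⟨x, p₂.reverse, s₂.reverse, ?_, ?_, ?_, ?_, ?_⟩
    · rw [dist_comm]; simp only [Walk.length_reverse]; omega
    · rw [dist_comm]; omega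
    · simp only [Walk.length_reverse]; omega
    · intro z hz
      exact hx z (by rw [Walk.mem_support_append_iff]; right; simpa using hz)
    · intro z hz
      have hz : z ∈ p₁.support := by
        rw [hs, Walk.mem_support_append_iff]; right; simpa using hz
      exact ⟨hx z (by rw [Walk.mem_support_append_iff]; exact Or.inl hz), hy z hz⟩
  by_cases hyu : y = u
  · left
    rw [← hyu]
    exact hact.mem_twoStepReach
  · right
    have hpos : 0 < s₁.length := by
      rw [Nat.pos_iff_ne_zero]
      exact fun h0 => hyu (Walk.eq_of_length_eq_zero h0).symm
    refine ⟨(c y, ⟨s₁.length - 1, by omega⟩, geodesicSign G σ u y), ?_, ?_⟩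
    · simp only [reachLabels, Finset.mem_filter, Finset.mem_univ, true_and]
      refine ⟨y, ⟨hyu, s₁.reverse, by rw [Walk.length_reverse, h1],
        by rw [Walk.length_reverse]; omega, fun z hz => hy z ?_⟩, rfl, by omega, rfl⟩
      rw [hs, Walk.mem_support_append_iff]; left; simpa using hz
    · simp only [conflictLabels, Finset.mem_filter, Finset.mem_univ, true_and]
      refine ⟨y, hact, rfl, ?_, geodesicSign_ne hneg s₁ (s₂.append p₂) hlen'⟩
      rw [dist_comm]; omega

/-- A family of label sets which separates small disjoint sets of labels often enough yields
a colouring of the exact-distance graph. -/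
lemma colorable_exactDistNeg_of_family {V τ : Type} [Fintype V] [Fintype τ] (G : SimpleGraph V)
    (σ : Sym2 V → Bool) {L₁ L₂ : LinearOrder V} {k h d q : ℕ} (hk : 1 ≤ k) (hkh : k ≤ 2 * h + 1)
    (hd : ∀ y, (WReach G L₁ k y).ncard ≤ d) (hq : ∀ y, (WReach G L₂ h y).ncard ≤ q)
    (U : τ → Finset (Fin (2 * (d * q) + 1) × Fin h × Bool))
    (hU : ∀ S B, Disjoint S B → S.card < q → B.card ≤ d * q →
      ∃ Z : Finset τ, 2 * (d * q) + 1 ≤ Z.card ∧ ∀ t ∈ Z, S ⊆ U t ∧ Disjoint B (U t)) :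
    (exactDistNeg G σ k).Colorable (Fintype.card τ) := by
  obtain ⟨c, -, hc⟩ := exists_list_colouring (twoStepReach G L₁ L₂ k h) (d * q)
    (card_twoStepReach_le hd hq) (fun _ => (Finset.univ : Finset (Fin (2 * (d * q) + 1))))
    (fun _ => by simp)
  choose Z hZ hZU using fun v => hU _ _ (disjoint_reachLabels_conflictLabels σ hc v)
    (card_reachLabels_lt σ hq c v) (card_conflictLabels_le σ hd hq c v)
  obtain ⟨F, hF, hFA⟩ := exists_list_colouring (twoStepReach G L₁ L₂ k h) (d * q)
    (card_twoStepReach_le hd hq) Z hZ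
  have key : ∀ u v, u ≠ v → G.dist u v = k →
      (∀ p : G.Walk u v, p.length = G.dist u v → IsNegWalk σ p) →
      ∀ (x : V) (p₁ : G.Walk u x) (p₂ : G.Walk x v), (p₁.append p₂).length = G.dist u v →
      (∀ z ∈ (p₁.append p₂).support, L₁.le x z) → p₁.length ≤ h → F u ≠ F v := by
    intro u v huv hdist hneg x p₁ p₂ hlen hx hh
    rcases mem_twoStepReach_or_exists_label (L₂ := L₂) c hdist hneg p₁ p₂ hlen hx hh with
      hA | ⟨ω, hω1, hω2⟩
    · exact hFA u v huv hA
    · intro hFe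
      have h1 := (hZU u _ (hF u)).1 hω1
      rw [hFe] at h1
      exact Finset.disjoint_left.1 (hZU v _ (hF v)).2 hω2 h1
  have main : ∀ u v, u ≠ v → G.dist u v = k →
      (∀ p : G.Walk u v, p.IsPath → p.length = k → IsNegWalk σ p) → F u ≠ F v := by
    intro u v huv hdist hneg
    have hneg' : ∀ p : G.Walk u v, p.length = G.dist u v → IsNegWalk σ p := fun p hp =>
      hneg p (p.isPath_of_length_eq_dist hp) (hp.trans hdist)
    have hneg'' : ∀ p : G.Walk v u, p.length = G.dist v u → IsNegWalk σ p := fun p hp => by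
      have := hneg' p.reverse (by rw [Walk.length_reverse, hp, dist_comm])
      unfold IsNegWalk at *
      rwa [negCount_reverse] at this
    obtain ⟨P, hP⟩ := (Reachable.of_dist_ne_zero
      (by omega : G.dist u v ≠ 0)).exists_walk_length_eq_dist
    obtain ⟨x, p₁, p₂, rfl, hx⟩ := P.exists_append_minimal L₁
    by_cases hh : p₁.length ≤ h
    · exact key u v huv hdist hneg' x p₁ p₂ hP hx hh
    · refine (key v u huv.symm (by rw [dist_comm, hdist]) hneg'' x p₂.reverse p₁.reverse ?_ ?_
        ?_).symm
      · rw [← Walk.reverse_append, Walk.length_reverse, hP, dist_comm]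
      · intro z hz
        rw [← Walk.reverse_append] at hz
        exact hx z (by simpa [or_comm] using hz)
      · rw [Walk.length_append] at hP
        rw [Walk.length_reverse]
        omega
  refine (Coloring.mk F ?_).colorable
  rintro u v ⟨huv, h | h⟩
  · exact main u v huv h.1 h.2
  · exact (main v u huv.symm h.1 h.2).symm

lemma card_finset_card_lt (Ω : Type) [Fintype Ω] [DecidableEq Ω] (q : ℕ) :
    Fintype.card {S : Finset Ω // S.card < q} =
      ∑ i ∈ Finset.range q, (Fintype.card Ω).choose i := by
  rw [Fintype.card_subtype, Finset.card_eq_sum_card_fiberwise (f := Finset.card)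
    (t := Finset.range q) (by intro S hS; simpa using hS)]
  refine Finset.sum_congr rfl fun i hi => ?_
  rw [← Finset.card_univ, ← Finset.card_powersetCard]
  congr 1
  ext S
  simp only [Finset.mem_filter, Finset.mem_univ, true_and, Finset.mem_powersetCard,
    Finset.subset_univ]
  have := Finset.mem_range.1 hi
  omega

/-- Colouring the exact-distance graph by using all small sets of labels, each many times. -/
lemma colorable_exactDistNeg_sum_choose {V : Type} [Fintype V] (G : SimpleGraph V)
    (σ : Sym2 V → Bool) {L₁ L₂ : LinearOrder V} {k h d q : ℕ} (hk : 1 ≤ k) (hkh : k ≤ 2 * h + 1)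
    (hd : ∀ y, (WReach G L₁ k y).ncard ≤ d) (hq : ∀ y, (WReach G L₂ h y).ncard ≤ q) :
    (exactDistNeg G σ k).Colorable ((2 * (d * q) + 1) *
      ∑ i ∈ Finset.range q, ((2 * (d * q) + 1) * (h * 2)).choose i) := by
  classical
  have := colorable_exactDistNeg_of_family G σ hk hkh hd hq
    (τ := Fin (2 * (d * q) + 1) ×
      {S : Finset (Fin (2 * (d * q) + 1) × Fin h × Bool) // S.card < q})
    (fun t => t.2.1) (fun S B hSB hS _ =>
      ⟨Finset.univ.image fun i => (i, ⟨S, hS⟩), ?_, ?_⟩)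
  · simpa only [Fintype.card_prod, Fintype.card_fin, Fintype.card_bool, card_finset_card_lt]
      using this
  · rw [Finset.card_image_of_injective _ (fun i j hij => (Prod.mk.inj hij).1)]
    simp
  · intro t ht
    obtain ⟨i, -, rfl⟩ := Finset.mem_image.1 ht
    exact ⟨subset_rfl, hSB.symm⟩

/-- The proportion of the functions to `Fin (d + 1)` which vanish on `S` and nowhere on `B`. -/
lemma card_filter_separating {Ω : Type} [Fintype Ω] [DecidableEq Ω] (d : ℕ) {S B : Finset Ω}
    (hSB : Disjoint S B) :
    (((Finset.univ : Finset (Ω → Fin (d + 1))).filter fun f =>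
      (∀ ω ∈ S, f ω = 0) ∧ ∀ ω ∈ B, f ω ≠ 0).card : ℝ) =
      (d + 1 : ℝ) ^ Fintype.card Ω * ((1 / (d + 1)) ^ S.card * (d / (d + 1)) ^ B.card) := by
  have hpos : (0 : ℝ) < d + 1 := by positivity
  have h : ((Finset.univ : Finset (Ω → Fin (d + 1))).filter fun f =>
      (∀ ω ∈ S, f ω = 0) ∧ ∀ ω ∈ B, f ω ≠ 0) = Fintype.piFinset (fun ω =>
        if ω ∈ S then {0} else if ω ∈ B then Finset.univ.erase 0 else Finset.univ) := by
    ext f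
    simp only [Finset.mem_filter, Finset.mem_univ, true_and, Fintype.mem_piFinset]
    constructor
    · rintro ⟨h1, h2⟩ ω
      split_ifs with hS hB
      · simpa using h1 ω hS
      · simpa using h2 ω hB
      · simp
    · intro h
      refine ⟨fun ω hω => ?_, fun ω hω => ?_⟩
      · have := h ω
        rw [if_pos hω] at this
        simpa using this
      · have := h ω
        rw [if_neg (Finset.disjoint_right.1 hSB hω), if_pos hω] at this
        simpa using this
  have hw : ∀ ω, (((if ω ∈ S then {0} else if ω ∈ B then Finset.univ.erase 0
      else Finset.univ : Finset (Fin (d + 1))).card : ℕ) : ℝ) =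
      (d + 1) * ((if ω ∈ S then (1 / (d + 1) : ℝ) else 1) *
        (if ω ∈ B then (d / (d + 1) : ℝ) else 1)) := by
    intro ω
    by_cases hS : ω ∈ S
    · rw [if_pos hS, if_pos hS, if_neg (Finset.disjoint_left.1 hSB hS)]
      simp [hpos.ne']
    · rw [if_neg hS, if_neg hS]
      by_cases hB : ω ∈ B
      · rw [if_pos hB, if_pos hB]
        rw [Finset.card_erase_of_mem (Finset.mem_univ _)]
        simp
        field_simp
      · rw [if_neg hB, if_neg hB]
        simp
  rw [h, Fintype.card_piFinset, Nat.cast_prod, Finset.prod_congr rfl fun ω _ => hw ω,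
    Finset.prod_mul_distrib, Finset.prod_mul_distrib, Finset.prod_ite_mem, Finset.prod_ite_mem]
  simp only [Finset.univ_inter, Finset.prod_const, Finset.card_univ]

lemma one_third_le_div_succ_pow (d : ℕ) : (1 / 3 : ℝ) ≤ (d / (d + 1)) ^ d := by
  rcases Nat.eq_zero_or_pos d with rfl | hd
  · norm_num
  have hd' : (0 : ℝ) < d := by exact_mod_cast hd
  have h : ((d + 1 : ℝ) / d) ^ d ≤ 3 := by
    calc ((d + 1 : ℝ) / d) ^ d ≤ (Real.exp (1 / d)) ^ d := by
          gcongr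
          have := Real.add_one_le_exp (1 / d : ℝ)
          rw [add_div, div_self hd'.ne']
          linarith
      _ = Real.exp 1 := by
          rw [← Real.exp_nat_mul, mul_one_div_cancel hd'.ne']
      _ ≤ 3 := Real.exp_one_lt_three.le
  rw [← inv_div ((d : ℝ) + 1), inv_pow, one_div]
  exact inv_anti₀ (by positivity) h

lemma le_card_filter_separating {Ω : Type} [Fintype Ω] [DecidableEq Ω] {d q : ℕ} {S B : Finset Ω}
    (hSB : Disjoint S B) (hS : S.card < q) (hB : B.card ≤ d * q) :
    (d + 1 : ℝ) ^ Fintype.card Ω * (1 / ((d + 1) ^ (q - 1) * 3 ^ q)) ≤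
    (((Finset.univ : Finset (Ω → Fin (d + 1))).filter fun f =>
      (∀ ω ∈ S, f ω = 0) ∧ ∀ ω ∈ B, f ω ≠ 0).card : ℝ) := by
  have hpos : (0 : ℝ) < d + 1 := by positivity
  have hle : (d / (d + 1) : ℝ) ≤ 1 := by
    rw [div_le_one hpos]; linarith
  rw [card_filter_separating d hSB]
  refine mul_le_mul_of_nonneg_left ?_ (by positivity)
  calc (1 / ((d + 1) ^ (q - 1) * 3 ^ q) : ℝ) = (1 / (d + 1)) ^ (q - 1) * (1 / 3) ^ q := by
        rw [one_div_pow, one_div_pow, one_div_mul_one_div]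
    _ ≤ (1 / (d + 1)) ^ S.card * (d / (d + 1)) ^ B.card := by
        gcongr ?_ * ?_
        · refine pow_le_pow_of_le_one (by positivity) ?_ (by omega)
          rw [div_le_one hpos]
          linarith [(Nat.cast_nonneg d : (0 : ℝ) ≤ d)]
        · calc ((1 / 3 : ℝ)) ^ q ≤ ((d / (d + 1)) ^ d) ^ q := by
                gcongr
                exact one_third_le_div_succ_pow d
            _ = (d / (d + 1)) ^ (d * q) := by rw [pow_mul]
            _ ≤ _ := pow_le_pow_of_le_one (by positivity) hle hB

/-- A first moment bound: if each of the events `good p` has probability at least `r`, then some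
sequence of length `T` satisfies each of them more than `g` times. -/
lemma exists_sequence_card_filter_gt {P α : Type} [Fintype P] [Fintype α] [Nonempty α]
    (good : P → α → Prop) [∀ p, DecidablePred (good p)] {r : ℝ} {T g : ℕ}
    (hgood : ∀ p, Fintype.card α * r ≤ ((Finset.univ.filter (good p)).card : ℝ))
    (hT : Fintype.card P * (1 - r / 2) ^ T < (1 / 2 : ℝ) ^ g) :
    ∃ U : Fin T → α, ∀ p, g < (Finset.univ.filter fun t => good p (U t)).card := by
  classical
  let f : P → α → ℝ := fun p a => if good p a then 1 / 2 else 1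
  have hf0 : ∀ p a, 0 ≤ f p a := fun p a => by
    simp only [f]; split_ifs <;> norm_num
  have hfsum : ∀ p, ∑ a, f p a ≤ Fintype.card α * (1 - r / 2) := by
    intro p
    have h1 : ∑ a, f p a = Fintype.card α - ((Finset.univ.filter (good p)).card : ℝ) / 2 := by
      have : ∀ a, f p a = 1 - (if good p a then 1 else 0) / 2 := fun a => by
        simp only [f]; split_ifs <;> norm_num
      simp only [this, Finset.sum_sub_distrib, ← Finset.sum_div, Finset.sum_boole]
      simp
    rw [h1]
    linarith [hgood p]
  have hα : (0 : ℝ) < Fintype.card α := by exact_mod_cast Fintype.card_pos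
  obtain ⟨U, -, hU⟩ := Finset.exists_le_of_sum_le (s := (Finset.univ : Finset (Fin T → α)))
    (f := fun U => ∑ p, ∏ t, f p (U t))
    (g := fun _ => Fintype.card P * (1 - r / 2) ^ T) Finset.univ_nonempty (by
      rw [Finset.sum_comm]
      calc ∑ p, ∑ U : Fin T → α, ∏ t, f p (U t) = ∑ p, (∑ a, f p a) ^ T := by
            simp only [Fintype.sum_pow]
        _ ≤ ∑ p : P, (Fintype.card α * (1 - r / 2)) ^ T := by
            refine Finset.sum_le_sum fun p _ => ?_
            exact pow_le_pow_left₀ (Finset.sum_nonneg fun a _ => hf0 p a) (hfsum p) T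
        _ = _ := by
            simp [mul_pow]
            ring)
  refine ⟨U, fun p => ?_⟩
  have h1 : ∏ t, f p (U t) = (1 / 2) ^ (Finset.univ.filter fun t => good p (U t)).card := by
    simp only [f]
    rw [Finset.prod_ite]
    simp
  have h2 : ∏ t, f p (U t) ≤ ∑ p, ∏ t, f p (U t) :=
    Finset.single_le_sum (f := fun p => ∏ t, f p (U t))
      (fun p _ => Finset.prod_nonneg fun t _ => hf0 p _) (Finset.mem_univ p)
  rw [h1] at h2
  by_contra hcon
  have h3 : (1 / 2 : ℝ) ^ g ≤ (1 / 2) ^ (Finset.univ.filter fun t => good p (U t)).card :=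
    pow_le_pow_of_le_one (by norm_num) (by norm_num) (not_lt.1 hcon)
  linarith

/-- A sufficiently long random sequence of sets separates all pairs of small disjoint sets often. -/
lemma exists_separating_family (Ω : Type) [Fintype Ω] [DecidableEq Ω] {d q T g : ℕ}
    (hT : (g + 2 * Fintype.card Ω) * Real.log 2 < T * (1 / ((d + 1) ^ (q - 1) * 3 ^ q)) / 2) :
    ∃ U : Fin T → Finset Ω, ∀ S B, Disjoint S B → S.card < q → B.card ≤ d * q →
      ∃ Z : Finset (Fin T), g ≤ Z.card ∧ ∀ t ∈ Z, S ⊆ U t ∧ Disjoint B (U t) := by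
  set r : ℝ := 1 / ((d + 1) ^ (q - 1) * 3 ^ q) with hr_def
  have hr : r ≤ 1 := by
    rw [hr_def, div_le_one (by positivity)]
    exact one_le_mul_of_one_le_of_one_le
      (one_le_pow₀ (by linarith [(Nat.cast_nonneg d : (0 : ℝ) ≤ d)])) (one_le_pow₀ (by norm_num))
  let P := {p : Finset Ω × Finset Ω // Disjoint p.1 p.2 ∧ p.1.card < q ∧ p.2.card ≤ d * q}
  have hP : (Fintype.card P : ℝ) ≤ 2 ^ (2 * Fintype.card Ω) := by
    have := Fintype.card_subtype_le (fun p : Finset Ω × Finset Ω =>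
      Disjoint p.1 p.2 ∧ p.1.card < q ∧ p.2.card ≤ d * q)
    rw [Fintype.card_prod, Fintype.card_finset, ← pow_add, ← two_mul] at this
    exact_mod_cast this
  obtain ⟨U, hU⟩ := exists_sequence_card_filter_gt (P := P) (α := Ω → Fin (d + 1)) (r := r)
    (T := T) (g := g) (fun p f => (∀ ω ∈ p.1.1, f ω = 0) ∧ ∀ ω ∈ p.1.2, f ω ≠ 0)
    (fun p => by
      have := le_card_filter_separating p.2.1 p.2.2.1 p.2.2.2
      rwa [← hr_def, show ((d : ℝ) + 1) ^ Fintype.card Ω =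
        (Fintype.card (Ω → Fin (d + 1)) : ℝ) by simp] at this) (by
      calc (Fintype.card P : ℝ) * (1 - r / 2) ^ T
          ≤ 2 ^ (2 * Fintype.card Ω) * (Real.exp (-(r / 2))) ^ T := by
            refine mul_le_mul hP (pow_le_pow_left₀ (by linarith) (Real.one_sub_le_exp_neg _) T)
              (pow_nonneg (by linarith) T) (by positivity)
        _ = Real.exp ((2 * Fintype.card Ω) * Real.log 2 - T * r / 2) := by
            rw [← Real.exp_nat_mul, sub_eq_add_neg, Real.exp_add]
            congr 1
            · have := Real.exp_nat_mul (Real.log 2) (2 * Fintype.card Ω)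
              rw [Real.exp_log two_pos] at this
              rw [← this]
              push_cast
              rfl
            · congr 1
              ring
        _ < Real.exp (-(g * Real.log 2)) := by
            rw [Real.exp_lt_exp]
            linarith
        _ = (1 / 2) ^ g := by
            rw [Real.exp_neg, Real.exp_nat_mul, Real.exp_log two_pos, one_div, inv_pow])
  refine ⟨fun t => Finset.univ.filter fun ω => U t ω = 0, fun S B hSB hS hB => ?_⟩
  refine ⟨_, (hU ⟨(S, B), hSB, hS, hB⟩).le, fun t ht => ?_⟩
  obtain ⟨h1, h2⟩ := (Finset.mem_filter.1 ht).2
  refine ⟨fun ω hω => by simpa using h1 ω hω, ?_⟩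
  rw [Finset.disjoint_left]
  intro ω hω
  simpa using h2 ω hω

lemma fourteen_mul_le_five_mul_pow {q h : ℕ} (hqh : q = 3 ∧ 3 ≤ h ∨ 4 ≤ q) :
    14 * q * (1 + 4 * h) ≤ 5 * (h + 2) ^ q := by
  rcases hqh with ⟨rfl, hh⟩ | hq
  · obtain ⟨j, rfl⟩ := Nat.exists_eq_add_of_le hh
    ring_nf
    nlinarith [sq_nonneg j]
  · induction q, hq using Nat.le_induction with
    | base =>
      rcases Nat.eq_zero_or_pos h with rfl | hpos
      · norm_num
      · obtain ⟨j, rfl⟩ := Nat.exists_eq_add_of_le hpos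
        ring_nf
        nlinarith [sq_nonneg j, pow_nonneg (Nat.zero_le j) 3]
    | succ q hq ih =>
      calc 14 * (q + 1) * (1 + 4 * h) ≤ 14 * (q * 2) * (1 + 4 * h) := by gcongr; omega
        _ = 14 * q * (1 + 4 * h) * 2 := by ring
        _ ≤ 5 * (h + 2) ^ q * (h + 2) := by gcongr; omega
        _ = _ := by ring

lemma colorable_exactDistNeg_pow {V : Type} [Fintype V] (G : SimpleGraph V)
    (σ : Sym2 V → Bool) {L₁ L₂ : LinearOrder V} {k h d q : ℕ} (hk : 1 ≤ k) (hkh : k ≤ 2 * h + 1)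
    (hd : ∀ y, (WReach G L₁ k y).ncard ≤ d) (hq : ∀ y, (WReach G L₂ h y).ncard ≤ q)
    (hqh : q = 3 ∧ 3 ≤ h ∨ 4 ≤ q) :
    (exactDistNeg G σ k).Colorable (((d + 1) * (h + 2) * 3) ^ q) := by
  obtain ⟨U, hU⟩ := exists_separating_family (Fin (2 * (d * q) + 1) × Fin h × Bool)
    (d := d) (q := q) (T := ((d + 1) * (h + 2) * 3) ^ q) (g := 2 * (d * q) + 1) (by
      have hq1 : (1 : ℝ) ≤ q := by
        have : 1 ≤ q := by omega
        exact_mod_cast this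
      have hnum : (14 * q * (1 + 4 * h) : ℝ) ≤ 5 * (h + 2) ^ q := by
        exact_mod_cast fourteen_mul_le_five_mul_pow hqh
      obtain ⟨e, rfl⟩ : ∃ e, q = e + 1 := ⟨q - 1, by omega⟩
      have hlog := Real.log_two_lt_d9
      have hlog0 := Real.log_pos one_lt_two
      have hd0 : (0 : ℝ) ≤ d := Nat.cast_nonneg d
      have hh0 : (0 : ℝ) ≤ h := Nat.cast_nonneg h
      simp only [Fintype.card_prod, Fintype.card_fin, Fintype.card_bool, Nat.add_sub_cancel]
      push_cast at *
      have hR : ((d + 1 : ℝ) * (h + 2) * 3) ^ (e + 1) * (1 / ((d + 1) ^ e * 3 ^ (e + 1))) / 2 =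
          (d + 1) * (h + 2) ^ (e + 1) / 2 := by
        rw [mul_pow, mul_pow, pow_succ (d + 1 : ℝ)]
        field_simp
      rw [hR]
      calc (2 * (d * (e + 1)) + 1 + 2 * ((2 * (d * (e + 1)) + 1) * (h * 2)) : ℝ) * Real.log 2
          = (2 * (d * (e + 1)) + 1) * (1 + 4 * h) * Real.log 2 := by ring
        _ < (2 * (d * (e + 1)) + 1) * (1 + 4 * h) * 0.7 := by
          gcongr
          linarith
        _ ≤ (2 * (e + 1) * (d + 1)) * (1 + 4 * h) * 0.7 := by
          gcongr
          linarith
        _ = (d + 1) * (14 * (e + 1) * (1 + 4 * h)) / 10 := by ring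
        _ ≤ (d + 1) * (5 * (h + 2) ^ (e + 1)) / 10 := by gcongr
        _ = _ := by ring)
  simpa using colorable_exactDistNeg_of_family G σ hk hkh hd hq U hU

lemma mul_sum_choose_le_pow {d h q : ℕ} (hd : 1 ≤ d) (hq : 1 ≤ q)
    (hqh : ¬(q = 3 ∧ 3 ≤ h ∨ 4 ≤ q)) :
    (2 * (d * q) + 1) * ∑ i ∈ Finset.range q, ((2 * (d * q) + 1) * (h * 2)).choose i ≤
      ((d + 1) * (h + 2) * 3) ^ q := by
  have hq3 : q ≤ 3 := by omega
  interval_cases q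
  · simp
    nlinarith
  · simp [Finset.sum_range_succ]
    nlinarith [mul_nonneg (Nat.zero_le d) (Nat.zero_le h),
      mul_nonneg (Nat.zero_le (d * d)) (Nat.zero_le h),
      mul_nonneg (Nat.zero_le (d * d)) (Nat.zero_le (h * h)),
      mul_nonneg (Nat.zero_le d) (Nat.zero_le (h * h)), Nat.zero_le (h * h), Nat.zero_le (d * d)]
  · have hh : h ≤ 2 := by omega
    have h2 : ∀ m, 2 * m.choose 2 ≤ m * m := fun m => by
      rw [Nat.choose_two_right]
      have := Nat.mul_div_le (m * (m - 1)) 2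
      have := Nat.mul_le_mul_left m (Nat.sub_le m 1)
      omega
    simp only [Finset.sum_range_succ, Finset.sum_range_zero, Nat.choose_zero_right,
      Nat.choose_one_right]
    have h3 := Nat.mul_le_mul_left (2 * (d * 3) + 1) (h2 ((2 * (d * 3) + 1) * (h * 2)))
    interval_cases h <;> ring_nf at h3 ⊢ <;> nlinarith

theorem exactDistNeg_chromatic_le_function_of_wcol_k
    {V : Type} [Fintype V] (G : SimpleGraph V) (σ : Sym2 V → Bool) (k : ℕ) (hk : 1 ≤ k) :
    (exactDistNeg G σ k).chromaticNumber ≤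
      ((((wcol G k + 1) * (k / 2 + 2) * 3) ^ (wcol G (k / 2)) : ℕ) : ℕ∞) := by
  refine Colorable.chromaticNumber_le ?_
  rcases isEmpty_or_nonempty V with hV | ⟨⟨v⟩⟩
  · exact (Colorable.of_isEmpty 0).mono (Nat.zero_le _)
  obtain ⟨L₁, hd⟩ := exists_order_wcol G k
  obtain ⟨L₂, hq⟩ := exists_order_wcol G (k / 2)
  have hpos : ∀ (L : LinearOrder V) (j : ℕ), 1 ≤ (WReach G L j v).ncard := fun L j =>
    (Set.ncard_pos (Set.toFinite _)).2
      ⟨v, mem_WReach_of_walk (Walk.nil : G.Walk v v) (by simp) (by simp)⟩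
  by_cases hqh : wcol G (k / 2) = 3 ∧ 3 ≤ k / 2 ∨ 4 ≤ wcol G (k / 2)
  · exact colorable_exactDistNeg_pow G σ hk (by omega) hd hq hqh
  · exact (colorable_exactDistNeg_sum_choose G σ hk (by omega) hd hq).mono
      (mul_sum_choose_le_pow ((hpos L₁ k).trans (hd v)) ((hpos L₂ _).trans (hq v)) hqh)
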